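/- arXiv:1705.00079 — 2 statements merged into one kernel-verified Lean document; each statement's English description precedes it below -/
import Mathlib

section
/- Let u_*(y) = tanh(y/√2). Let g : ℝ → ℝ be continuous, let γ ∈ ℝ, and let v : ℝ → ℝ be twice continuously differentiable with v and v' bounded on ℝ, satisfying v''(y) + v(y) − 3u_*(y)²v(y) + γ·u_*'(y) + g(u_*(y)) = 0 for all y ∈ ℝ. Then the integrals ∫_ℝ (u_*'(y))² dy and ∫_ℝ g(u_*(y))u_*'(y) dy converge, ∫_ℝ (u_*'(y))² dy > 0, and γ = −(∫_ℝ g(u_*(y))u_*'(y) dy) / (∫_ℝ (u_*'(y))² dy). -/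
open MeasureTheory

theorem Real.hasDerivAt_tanh (x : ℝ) : HasDerivAt Real.tanh (1 - Real.tanh x ^ 2) x := by
  have hc := (Real.cosh_pos x).ne'
  have h := (Real.hasDerivAt_sinh x).div (Real.hasDerivAt_cosh x) hc
  have hfun : Real.tanh = Real.sinh / Real.cosh :=
    funext fun y => Real.tanh_eq_sinh_div_cosh y
  rw [hfun]
  refine h.congr_deriv ?_
  simp only [Pi.div_apply]
  field_simp

theorem Real.one_sub_tanh_sq_le (x : ℝ) : 1 - Real.tanh x ^ 2 ≤ (1 + x ^ 2)⁻¹ := by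
  have hc := Real.cosh_pos x
  have hs : x ^ 2 ≤ Real.sinh x ^ 2 := by
    rw [sq_le_sq, Real.abs_sinh]
    exact Real.self_le_sinh_iff.2 (abs_nonneg x)
  have hcs := Real.cosh_sq x
  have h : 1 - Real.tanh x ^ 2 = (Real.cosh x ^ 2)⁻¹ := by
    rw [Real.tanh_eq_sinh_div_cosh]
    field_simp
    linarith
  rw [h]
  exact inv_anti₀ (by positivity) (by linarith)

theorem Real.integrable_one_sub_tanh_sq : Integrable fun x : ℝ => 1 - Real.tanh x ^ 2 := by
  have hcont : Continuous Real.tanh :=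
    continuous_iff_continuousAt.2 fun x => (Real.hasDerivAt_tanh x).continuousAt
  refine integrable_inv_one_add_sq.mono' (by fun_prop) (Filter.Eventually.of_forall fun x => ?_)
  rw [Real.norm_of_nonneg (sub_nonneg.2 (Real.tanh_sq_lt_one x).le)]
  exact Real.one_sub_tanh_sq_le x

/-- Solvability (Fredholm orthogonality) condition determining the linearized
normal front speed: if `v'' + v − 3u_*²v + γu_*' + g(u_*) = 0` has a bounded
solution `v` with bounded derivative, where `u_*(y) = tanh(y/√2)`, then
`γ = −(∫ g(u_*)u_*')/(∫ (u_*')²)`. -/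
theorem normal_speed_solvability
    (g : ℝ → ℝ) (hg : Continuous g) (γ : ℝ) (v : ℝ → ℝ)
    (hv_smooth : ContDiff ℝ 2 v)
    (hv_bdd : ∃ M : ℝ, ∀ y : ℝ, |v y| ≤ M)
    (hv'_bdd : ∃ M : ℝ, ∀ y : ℝ, |deriv v y| ≤ M)
    (heq : ∀ y : ℝ,
      deriv (deriv v) y + v y
        - 3 * (Real.tanh (y / Real.sqrt 2)) ^ 2 * v y
        + γ * deriv (fun y' : ℝ => Real.tanh (y' / Real.sqrt 2)) y
        + g (Real.tanh (y / Real.sqrt 2)) = 0) :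
    Integrable (fun y : ℝ =>
        (deriv (fun y' : ℝ => Real.tanh (y' / Real.sqrt 2)) y) ^ 2) volume ∧
    Integrable (fun y : ℝ =>
        g (Real.tanh (y / Real.sqrt 2))
          * deriv (fun y' : ℝ => Real.tanh (y' / Real.sqrt 2)) y) volume ∧
    (0 < ∫ y : ℝ, (deriv (fun y' : ℝ => Real.tanh (y' / Real.sqrt 2)) y) ^ 2) ∧
    γ = -(∫ y : ℝ, g (Real.tanh (y / Real.sqrt 2))
            * deriv (fun y' : ℝ => Real.tanh (y' / Real.sqrt 2)) y)
          / (∫ y : ℝ, (deriv (fun y' : ℝ => Real.tanh (y' / Real.sqrt 2)) y) ^ 2) := by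
  obtain ⟨M, hM⟩ := hv_bdd
  obtain ⟨M', hM'⟩ := hv'_bdd
  set u : ℝ → ℝ := fun y => Real.tanh (y / √2) with hu_def
  have h2 : √2 * √2 = 2 := Real.mul_self_sqrt (by norm_num)
  have h2_pos : 0 < √2 := by positivity
  have h2_ge : 1 ≤ √2 := Real.one_le_sqrt.2 (by norm_num)
  have hu (y : ℝ) : HasDerivAt u ((1 - u y ^ 2) / √2) y := by
    have h := (Real.hasDerivAt_tanh (y / √2)).comp y ((hasDerivAt_id y).div_const √2)
    exact h.congr_deriv (by simp only [hu_def]; ring)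
  have hu_cont : Continuous u := continuous_iff_continuousAt.2 fun y => (hu y).continuousAt
  have hu_abs (y : ℝ) : |u y| ≤ 1 := (Real.abs_tanh_lt_one _).le
  have hderiv : deriv u = fun y => (1 - u y ^ 2) / √2 := funext fun y => (hu y).deriv
  change ∀ y, deriv (deriv v) y + v y - 3 * u y ^ 2 * v y + γ * deriv u y + g (u y) = 0 at heq
  change Integrable (fun y => deriv u y ^ 2) ∧ Integrable (fun y => g (u y) * deriv u y) ∧
    (0 < ∫ y, deriv u y ^ 2) ∧ γ = -(∫ y, g (u y) * deriv u y) / ∫ y, deriv u y ^ 2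
  have hw_cont : Continuous (deriv u) := by rw [hderiv]; fun_prop
  have hw_pos (y : ℝ) : 0 < deriv u y := by
    rw [hderiv]
    exact div_pos (sub_pos.2 (Real.tanh_sq_lt_one _)) h2_pos
  have hw_le (y : ℝ) : deriv u y ≤ 1 := by
    simp only [hderiv]
    rw [div_le_one h2_pos]
    linarith [sq_nonneg (u y)]
  have hw_int : Integrable (deriv u) := by
    rw [hderiv]
    exact (Real.integrable_one_sub_tanh_sq.comp_div h2_pos.ne').div_const √2
  have hw_deriv (y : ℝ) : HasDerivAt (deriv u) (-(√2 * u y * deriv u y)) y := by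
    have h := (((hu y).pow 2).const_sub 1).div_const √2
    rw [hderiv]
    refine h.congr_deriv ?_
    field_simp
    linear_combination (u y * (1 - u y ^ 2)) * h2
  have hv' : ContDiff ℝ 1 (deriv v) := hv_smooth.deriv'
  have hv'_cont : Continuous (deriv v) := hv'.continuous
  have hv_cont : Continuous v := hv_smooth.continuous
  have hvd (y : ℝ) : HasDerivAt v (deriv v y) y :=
    (hv_smooth.differentiable (by norm_num) y).hasDerivAt
  have hvd' (y : ℝ) : HasDerivAt (deriv v) (deriv (deriv v) y) y :=
    (hv'.differentiable (by norm_num) y).hasDerivAt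
  have hsq : Integrable fun y => deriv u y ^ 2 := by
    simp only [sq]
    refine hw_int.bdd_mul (c := 1) hw_cont.aestronglyMeasurable
      (Filter.Eventually.of_forall fun y => ?_)
    rw [Real.norm_of_nonneg (hw_pos y).le]
    exact hw_le y
  have hgw : Integrable fun y => g (u y) * deriv u y := by
    obtain ⟨C, hC⟩ := (isCompact_Icc (a := (-1 : ℝ)) (b := 1)).exists_bound_of_continuousOn
      hg.continuousOn
    exact hw_int.bdd_mul (hg.comp hu_cont).aestronglyMeasurable
      (Filter.Eventually.of_forall fun y => hC _ (abs_le.1 (hu_abs y)))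
  have hpos : 0 < ∫ y, deriv u y ^ 2 :=
    integral_pos_of_integrable_nonneg_nonzero (x := 0) (hw_cont.pow 2) hsq
      (fun y => sq_nonneg _) (pow_pos (hw_pos 0) 2).ne'
  refine ⟨hsq, hgw, hpos, ?_⟩
  -- The Wronskian of `v` and `deriv u` is integrable, so its derivative has zero integral.
  have hF_int : Integrable fun y => (deriv v y + √2 * (u y * v y)) * deriv u y := by
    refine hw_int.bdd_mul (c := M' + √2 * (1 * M)) (by fun_prop)
      (Filter.Eventually.of_forall fun y => (norm_add_le _ _).trans ?_)
    rw [norm_mul, norm_mul, Real.norm_of_nonneg h2_pos.le]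
    gcongr
    · exact hM' y
    · exact hu_abs y
    · exact hM y
  have hF_deriv (y : ℝ) :
      HasDerivAt (fun y => (deriv v y + √2 * (u y * v y)) * deriv u y)
        (-(γ * deriv u y ^ 2 + g (u y) * deriv u y)) y := by
    have h := ((hvd' y).add (((hu y).mul (hvd y)).const_mul √2)).mul (hw_deriv y)
    refine h.congr_deriv ?_
    have hw : √2 * ((1 - u y ^ 2) / √2) = 1 - u y ^ 2 := by field_simp
    simp only [Pi.add_apply, Pi.mul_apply]
    linear_combination deriv u y * heq y + v y * deriv u y * hw
      - u y ^ 2 * v y * deriv u y * h2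
  have hzero := integral_eq_zero_of_hasDerivAt_of_integrable hF_deriv
    ((hsq.const_mul γ).add hgw).neg hF_int
  rw [integral_neg, integral_add (hsq.const_mul γ) hgw, integral_const_mul] at hzero
  rw [eq_div_iff hpos.ne']
  linarith
end

section
/- Let Ω ⊆ ℝ² be open, let c ∈ ℝ, let a : ℝ² → ℝ be any function, and let δ > 0. Let u, w : ℝ² → ℝ be twice continuously differentiable bounded functions such that: (i) Δu + c ∂_x u + a u = 0 at every point of ℝ²; (ii) u(p) > 0 for every p ∈ Ω; (iii) w(p) > 0 for every p ∈ ℝ²; (iv) Δw + c ∂_x w + a w ≤ −1/4 at every point of ℝ² ∖ Ω; (v) liminf_{‖p‖→∞} u(p) ≥ 0 and liminf_{‖p‖→∞} w(p) ≥ δ. Then u(p) ≥ 0 for every p ∈ ℝ². -/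
/-- Partial derivative in the first variable. -/
noncomputable def pdx (f : ℝ × ℝ → ℝ) : ℝ × ℝ → ℝ :=
  fun p => deriv (fun t => f (t, p.2)) p.1

/-- Partial derivative in the second variable. -/
noncomputable def pdy (f : ℝ × ℝ → ℝ) : ℝ × ℝ → ℝ :=
  fun p => deriv (fun t => f (p.1, t)) p.2

/-- Laplacian `Δf = ∂_x∂_x f + ∂_y∂_y f`. -/
noncomputable def lap (f : ℝ × ℝ → ℝ) : ℝ × ℝ → ℝ :=
  fun p => pdx (pdx f) p + pdy (pdy f) p

/-- Second-order necessary condition at a minimum of a real function. -/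
theorem IsLocalMin.deriv_deriv_nonneg {f : ℝ → ℝ} {x : ℝ} (hf : IsLocalMin f x)
    (hc : ContinuousAt f x) : 0 ≤ deriv (deriv f) x := by
  by_contra! h
  have hmax : IsLocalMax f x := isLocalMax_of_deriv_deriv_neg h hf.deriv_eq_zero hc
  have hconst : f =ᶠ[nhds x] fun _ => f x := by
    filter_upwards [hf, hmax] with y h1 h2 using le_antisymm h2 h1
  have : deriv (deriv f) x = 0 := by
    rw [hconst.deriv.deriv_eq]
    simp
  exact h.ne this

/-- First- and second-order conditions at a minimum of `f + κ g`, split along the sum. -/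
theorem deriv_conditions_of_forall_le_add_mul {f g : ℝ → ℝ} (hf : ContDiff ℝ 2 f)
    (hg : ContDiff ℝ 2 g) {κ x : ℝ} (h : ∀ t, f x + κ * g x ≤ f t + κ * g t) :
    deriv f x + κ * deriv g x = 0 ∧ 0 ≤ deriv (deriv f) x + κ * deriv (deriv g) x := by
  have hmin : IsLocalMin (fun t => f t + κ * g t) x := Filter.Eventually.of_forall h
  have hfd : Differentiable ℝ f := hf.differentiable (by norm_num)
  have hgd : Differentiable ℝ g := hg.differentiable (by norm_num)
  have hfd' : Differentiable ℝ (deriv f) :=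
    (show ContDiff ℝ (1 + 1) f by rwa [one_add_one_eq_two]).deriv'.differentiable one_ne_zero
  have hgd' : Differentiable ℝ (deriv g) :=
    (show ContDiff ℝ (1 + 1) g by rwa [one_add_one_eq_two]).deriv'.differentiable one_ne_zero
  have h1 : deriv (fun t => f t + κ * g t) = fun t => deriv f t + κ * deriv g t := by
    funext t
    exact ((hfd t).hasDerivAt.add ((hgd t).hasDerivAt.const_mul κ)).deriv
  have h2 : deriv (fun t => deriv f t + κ * deriv g t) x =
      deriv (deriv f) x + κ * deriv (deriv g) x :=
    ((hfd' x).hasDerivAt.add ((hgd' x).hasDerivAt.const_mul κ)).deriv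
  constructor
  · have := hmin.deriv_eq_zero
    rwa [h1] at this
  · have := hmin.deriv_deriv_nonneg (hf.continuous.add (hg.continuous.const_mul κ)).continuousAt
    rwa [h1, h2] at this

/-- First- and second-order conditions at a minimum of `u + κ w` in the plane. -/
theorem pdx_lap_conditions_of_forall_le_add_mul {u w : ℝ × ℝ → ℝ} (hu : ContDiff ℝ 2 u)
    (hw : ContDiff ℝ 2 w) {κ : ℝ} {q : ℝ × ℝ} (h : ∀ p, u q + κ * w q ≤ u p + κ * w p) :
    pdx u q + κ * pdx w q = 0 ∧ 0 ≤ lap u q + κ * lap w q := by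
  have hx := deriv_conditions_of_forall_le_add_mul (x := q.1) (κ := κ)
    (hu.comp (contDiff_id.prodMk contDiff_const : ContDiff ℝ 2 fun t : ℝ => (t, q.2)))
    (hw.comp (contDiff_id.prodMk contDiff_const : ContDiff ℝ 2 fun t : ℝ => (t, q.2)))
    fun t => h (t, q.2)
  have hy := deriv_conditions_of_forall_le_add_mul (x := q.2) (κ := κ)
    (hu.comp (contDiff_const.prodMk contDiff_id : ContDiff ℝ 2 fun t : ℝ => (q.1, t)))
    (hw.comp (contDiff_const.prodMk contDiff_id : ContDiff ℝ 2 fun t : ℝ => (q.1, t)))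
    fun t => h (q.1, t)
  have hyy : 0 ≤ pdy (pdy u) q + κ * pdy (pdy w) q := hy.2
  have hxx : 0 ≤ pdx (pdx u) q + κ * pdx (pdx w) q := hx.2
  refine ⟨hx.1, ?_⟩
  unfold lap
  linarith

/-- Sliding supersolution argument: if `u` solves `Δu + c∂_x u + au = 0`, is
positive on `Ω`, nonnegative at infinity, and `w > 0` is a strict supersolution
outside `Ω` bounded below by `δ > 0` at infinity, then `u ≥ 0` everywhere. -/
theorem sliding_supersolution
    (Ω : Set (ℝ × ℝ)) (hΩ : IsOpen Ω)
    (c : ℝ) (a : ℝ × ℝ → ℝ) (δ : ℝ) (hδ : 0 < δ)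
    (u w : ℝ × ℝ → ℝ)
    (hu_smooth : ContDiff ℝ 2 u) (hw_smooth : ContDiff ℝ 2 w)
    (hu_bdd : ∃ M : ℝ, ∀ p : ℝ × ℝ, |u p| ≤ M)
    (hw_bdd : ∃ M : ℝ, ∀ p : ℝ × ℝ, |w p| ≤ M)
    (hu_eq : ∀ p : ℝ × ℝ, lap u p + c * pdx u p + a p * u p = 0)
    (hu_pos : ∀ p ∈ Ω, 0 < u p)
    (hw_pos : ∀ p : ℝ × ℝ, 0 < w p)
    (hw_super : ∀ p ∈ Ωᶜ, lap w p + c * pdx w p + a p * w p ≤ -1/4)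
    (hu_inf : ∀ ε > 0, ∃ R > 0, ∀ p : ℝ × ℝ, R ≤ ‖p‖ → 0 - ε ≤ u p)
    (hw_inf : ∀ ε > 0, ∃ R > 0, ∀ p : ℝ × ℝ, R ≤ ‖p‖ → δ - ε ≤ w p) :
    ∀ p : ℝ × ℝ, 0 ≤ u p := by
  intro p₀
  by_contra! hp₀
  have hquot : Continuous fun p => u p / w p :=
    hu_smooth.continuous.div hw_smooth.continuous fun p => (hw_pos p).ne'
  have hneg : u p₀ / w p₀ < 0 := div_neg_of_neg_of_pos hp₀ (hw_pos p₀)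
  obtain ⟨R₁, -, h₁⟩ := hu_inf (-(u p₀ / w p₀) * (δ / 2)) (by nlinarith)
  obtain ⟨R₂, -, h₂⟩ := hw_inf (δ / 2) (by linarith)
  have hfar : ∀ᶠ p in Filter.cocompact (ℝ × ℝ), u p₀ / w p₀ ≤ u p / w p := by
    filter_upwards [(tendsto_norm_cocompact_atTop (E := ℝ × ℝ)).eventually_ge_atTop R₁,
      (tendsto_norm_cocompact_atTop (E := ℝ × ℝ)).eventually_ge_atTop R₂] with p hp₁ hp₂
    rw [le_div_iff₀ (hw_pos p)]
    have hu_far := h₁ p hp₁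
    have hw_far := h₂ p hp₂
    nlinarith
  obtain ⟨q, hq⟩ := hquot.exists_forall_le' p₀ hfar
  set κ : ℝ := -(u q / w q) with hκ
  have hκ_pos : 0 < κ := by linarith [hq p₀]
  have hzero : u q + κ * w q = 0 := by
    rw [hκ, neg_mul, div_mul_cancel₀ _ (hw_pos q).ne', add_neg_cancel]
  have hmin : ∀ p, u q + κ * w q ≤ u p + κ * w p := fun p => by
    have := (le_div_iff₀ (hw_pos p)).1 (hq p)
    rw [hzero, hκ]
    linarith
  have hqΩ : q ∈ Ωᶜ := fun hmem => by
    linarith [hu_pos q hmem, mul_pos hκ_pos (hw_pos q)]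
  obtain ⟨hd, hl⟩ := pdx_lap_conditions_of_forall_le_add_mul hu_smooth hw_smooth hmin
  have hsum : (lap u q + κ * lap w q) + c * (pdx u q + κ * pdx w q)
      + a q * (u q + κ * w q) ≤ -κ / 4 := by
    linarith [hu_eq q, mul_le_mul_of_nonneg_left (hw_super q hqΩ) hκ_pos.le]
  rw [hd, hzero] at hsum
  linarith
end
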